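/- For every n ≥ 1, the infimum of Σ_{j=1}^n x_j²/(n−j+1) over all (x_1,…,x_n) ∈ ℝ_{>0}^n satisfying the constraint x_1·x_2⋯x_n ≥ n! equals n·(n!)^{1/n}, and it is attained at the point x̄ with x̄_j = √(n−j+1)·(n!)^{1/(2n)} for j = 1,…,n. -/

import Mathlib

open Finset

theorem prod_natCast_sub_val_eq_factorial (n : ℕ) :
    ∏ i : Fin n, ((n : ℝ) - (i : ℕ)) = n.factorial := by
  induction n with
  | zero => simp
  | succ n ih => simp [Fin.prod_univ_succ, Nat.factorial_succ, ih]

theorem natCast_sub_val_pos {n : ℕ} (i : Fin n) : (0 : ℝ) < (n : ℝ) - (i : ℕ) :=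
  sub_pos.2 (Nat.cast_lt.2 i.isLt)

theorem card_mul_prod_rpow_le_sum {n : ℕ} (hn : 1 ≤ n) (z : Fin n → ℝ) (hz : ∀ i, 0 ≤ z i) :
    (n : ℝ) * (∏ i, z i) ^ ((1 : ℝ) / n) ≤ ∑ i, z i := by
  have hn' : (0 : ℝ) < n := by exact_mod_cast hn
  have h := Real.geom_mean_le_arith_mean univ (fun _ => (1 : ℝ)) z (fun _ _ => zero_le_one)
    (by simpa using hn') (fun i _ => hz i)
  simp only [Real.rpow_one, sum_const, card_univ, Fintype.card_fin, nsmul_eq_mul, mul_one,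
    one_mul, ← one_div] at h
  rw [le_div_iff₀ hn'] at h
  linarith

theorem mul_factorial_rpow_le_sum_sq_div {n : ℕ} (hn : 1 ≤ n) (x : Fin n → ℝ)
    (hx : (n.factorial : ℝ) ≤ ∏ i, x i) :
    (n : ℝ) * (n.factorial : ℝ) ^ ((1 : ℝ) / n) ≤ ∑ j, x j ^ 2 / ((n : ℝ) - (j : ℕ)) := by
  have hf : (0 : ℝ) < n.factorial := by exact_mod_cast n.factorial_pos
  refine le_trans ?_ (card_mul_prod_rpow_le_sum hn _ fun j =>
    div_nonneg (sq_nonneg (x j)) (natCast_sub_val_pos j).le)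
  rw [prod_div_distrib, prod_natCast_sub_val_eq_factorial, prod_pow]
  gcongr
  rw [le_div_iff₀ hf, ← sq]
  gcongr

/-- For every `n ≥ 1`, the infimum of `∑_{j=1}^n x_j²/(n-j+1)` over the positive orthant
subject to the constraint `x₁ ⋯ xₙ ≥ n!` equals `n (n!)^{1/n}`, and it is attained (so it is a
minimum, `IsLeast`) at the point `x̄` with `x̄_j = √(n-j+1) (n!)^{1/(2n)}`.  (Coordinates are
indexed by `j : Fin n`, so the paper's `n - j + 1` becomes `n - j`.) -/
theorem convex_program_solution (n : ℕ) (hn : 1 ≤ n) :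
    IsLeast
      {v : ℝ | ∃ x : Fin n → ℝ, (∀ i, 0 < x i) ∧ (n.factorial : ℝ) ≤ ∏ i : Fin n, x i ∧
        v = ∑ j : Fin n, x j ^ 2 / ((n : ℝ) - (j : ℕ))}
      ((n : ℝ) * (n.factorial : ℝ) ^ ((1 : ℝ) / n)) ∧
    (∀ i : Fin n,
        0 < Real.sqrt ((n : ℝ) - (i : ℕ)) * (n.factorial : ℝ) ^ (1 / (2 * (n : ℝ)))) ∧
    (n.factorial : ℝ) ≤
        ∏ i : Fin n, Real.sqrt ((n : ℝ) - (i : ℕ)) * (n.factorial : ℝ) ^ (1 / (2 * (n : ℝ))) ∧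
    ∑ j : Fin n, (Real.sqrt ((n : ℝ) - (j : ℕ)) * (n.factorial : ℝ) ^ (1 / (2 * (n : ℝ)))) ^ 2
          / ((n : ℝ) - (j : ℕ)) =
      (n : ℝ) * (n.factorial : ℝ) ^ ((1 : ℝ) / n) := by
  have hn' : (n : ℝ) ≠ 0 := by exact_mod_cast Nat.one_le_iff_ne_zero.1 hn
  have hf : (0 : ℝ) < n.factorial := by exact_mod_cast n.factorial_pos
  have hpos : ∀ i : Fin n,
      0 < Real.sqrt ((n : ℝ) - (i : ℕ)) * (n.factorial : ℝ) ^ (1 / (2 * (n : ℝ))) := fun i =>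
    mul_pos (Real.sqrt_pos.2 (natCast_sub_val_pos i)) (Real.rpow_pos_of_pos hf _)
  have hprod : (n.factorial : ℝ) ≤
      ∏ i : Fin n, Real.sqrt ((n : ℝ) - (i : ℕ)) * (n.factorial : ℝ) ^ (1 / (2 * (n : ℝ))) := by
    refine le_of_eq ?_
    rw [prod_mul_distrib, prod_const, card_univ, Fintype.card_fin, ← Real.rpow_mul_natCast hf.le,
      show 1 / (2 * (n : ℝ)) * n = 1 / 2 by field_simp, ← Real.sqrt_eq_rpow,
      ← Real.sqrt_prod _ fun i _ => (natCast_sub_val_pos i).le,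
      prod_natCast_sub_val_eq_factorial, Real.mul_self_sqrt hf.le]
  have hsum : ∑ j : Fin n,
      (Real.sqrt ((n : ℝ) - (j : ℕ)) * (n.factorial : ℝ) ^ (1 / (2 * (n : ℝ)))) ^ 2
          / ((n : ℝ) - (j : ℕ)) = (n : ℝ) * (n.factorial : ℝ) ^ ((1 : ℝ) / n) := by
    have hterm (j : Fin n) :
        (Real.sqrt ((n : ℝ) - (j : ℕ)) * (n.factorial : ℝ) ^ (1 / (2 * (n : ℝ)))) ^ 2
          / ((n : ℝ) - (j : ℕ)) = (n.factorial : ℝ) ^ ((1 : ℝ) / n) := by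
      have hj := natCast_sub_val_pos j
      rw [mul_pow, Real.sq_sqrt hj.le, mul_div_cancel_left₀ _ hj.ne', ← Real.rpow_mul_natCast hf.le]
      congr 1
      push_cast
      field_simp
    simp only [hterm, sum_const, card_univ, Fintype.card_fin, nsmul_eq_mul]
  refine ⟨⟨⟨_, hpos, hprod, hsum.symm⟩, ?_⟩, hpos, hprod, hsum⟩
  rintro v ⟨x, -, hx, rfl⟩
  exact mul_factorial_rpow_le_sum_sq_div hn x hx
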